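/- arXiv:1609.00710 — 2 statements merged into one kernel-verified Lean document; each statement's English description precedes it below -/
import Mathlib

section
/- For all μ ∈ ℝ, σ > 0, α ≠ 0, q ≠ 0 and a ≤ b in ℝ, writing v* = (v−μ)/σ, a* = (a−μ)/σ, b* = (b−μ)/σ: ∫_a^b Φ(v*/α − αq) · exp(−v* q + α²q²/2) dv = −(σ/q)·exp(α²q²/2)·[ Φ(b*/α − αq)·exp(−b* q) − Φ(a*/α − αq)·exp(−a* q) ] + (σ/q)·[ Φ(b*/α) − Φ(a*/α) ]. -/
open MeasureTheory Real Set

/-- Standard normal CDF. -/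
noncomputable def Phi (x : ℝ) : ℝ :=
  ∫ t in Set.Iic x, (Real.sqrt (2 * Real.pi))⁻¹ * Real.exp (-t ^ 2 / 2)

theorem integrable_standard_normal_density :
    Integrable fun t : ℝ => (Real.sqrt (2 * Real.pi))⁻¹ * Real.exp (-t ^ 2 / 2) := by
  have h := (integrable_exp_neg_mul_sq (b := 1 / 2) (by norm_num)).const_mul
    (Real.sqrt (2 * Real.pi))⁻¹
  convert h using 4 with t
  ring

theorem hasDerivAt_Phi (x : ℝ) :
    HasDerivAt Phi ((Real.sqrt (2 * Real.pi))⁻¹ * Real.exp (-x ^ 2 / 2)) x := by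
  have hi := integrable_standard_normal_density
  have hc : Continuous fun t : ℝ => (Real.sqrt (2 * Real.pi))⁻¹ * Real.exp (-t ^ 2 / 2) := by
    fun_prop
  have hPhi : Phi = fun y => Phi 0 +
      ∫ t in (0 : ℝ)..y, (Real.sqrt (2 * Real.pi))⁻¹ * Real.exp (-t ^ 2 / 2) := by
    funext y
    rw [← intervalIntegral.integral_Iic_sub_Iic hi.integrableOn hi.integrableOn]
    simp only [Phi]
    ring
  rw [hPhi]
  exact (hc.integral_hasStrictDerivAt 0 x).hasDerivAt.const_add _

theorem continuous_Phi : Continuous Phi :=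
  continuous_iff_continuousAt.2 fun x => (hasDerivAt_Phi x).continuousAt

/-- Tilting the shifted Gaussian kernel by `exp (-x q)` recentres it at the origin. -/
theorem exp_shifted_sq_mul_exp_tilt (x q : ℝ) {α : ℝ} (hα : α ≠ 0) :
    Real.exp (α ^ 2 * q ^ 2 / 2) *
        (Real.exp (-(x / α - α * q) ^ 2 / 2) * Real.exp (-(x * q))) =
      Real.exp (-(x / α) ^ 2 / 2) := by
  rw [← Real.exp_add, ← Real.exp_add]
  congr 1
  field_simp
  ring

/-- Integration-by-parts identity used for the first component of the GAL cdf. -/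
theorem gal_cdf_component_one (μ σ α q a b : ℝ) (hσ : 0 < σ) (hα : α ≠ 0)
    (hq : q ≠ 0) (hab : a ≤ b) :
    (∫ v in a..b,
        Phi ((v - μ) / σ / α - α * q) *
          Real.exp (-(((v - μ) / σ) * q) + α ^ 2 * q ^ 2 / 2)) =
      -(σ / q) * Real.exp (α ^ 2 * q ^ 2 / 2) *
          (Phi ((b - μ) / σ / α - α * q) * Real.exp (-(((b - μ) / σ) * q)) -
            Phi ((a - μ) / σ / α - α * q) * Real.exp (-(((a - μ) / σ) * q))) +
        (σ / q) * (Phi ((b - μ) / σ / α) - Phi ((a - μ) / σ / α)) := by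
  have hderiv : ∀ v : ℝ, HasDerivAt
      (fun v => -(σ / q) * Real.exp (α ^ 2 * q ^ 2 / 2) *
          (Phi ((v - μ) / σ / α - α * q) * Real.exp (-(((v - μ) / σ) * q))) +
        (σ / q) * Phi ((v - μ) / σ / α))
      (Phi ((v - μ) / σ / α - α * q) *
        Real.exp (-(((v - μ) / σ) * q) + α ^ 2 * q ^ 2 / 2)) v := by
    intro v
    have hstd : HasDerivAt (fun v : ℝ => (v - μ) / σ) (1 / σ) v :=
      ((hasDerivAt_id v).sub_const μ).div_const σ
    have hPhi := (hasDerivAt_Phi _).comp v (hstd.div_const α)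
    have hPhi_shift := (hasDerivAt_Phi _).comp v ((hstd.div_const α).sub_const (α * q))
    have hexp := (hstd.mul_const q).neg.exp
    refine (((hPhi_shift.mul hexp).const_mul _).add (hPhi.const_mul (σ / q))).congr_deriv ?_
    simp only [Function.comp_apply, Pi.neg_apply]
    rw [← exp_shifted_sq_mul_exp_tilt ((v - μ) / σ) q hα, Real.exp_add]
    have hσ' := hσ.ne'
    generalize Phi ((v - μ) / σ / α - α * q) = P
    generalize Real.exp (-((v - μ) / σ / α - α * q) ^ 2 / 2) = A
    generalize Real.exp (-((v - μ) / σ * q)) = B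
    generalize Real.exp (α ^ 2 * q ^ 2 / 2) = C
    generalize (Real.sqrt (2 * Real.pi))⁻¹ = D
    field_simp
    ring
  have hcont : Continuous fun v => Phi ((v - μ) / σ / α - α * q) *
      Real.exp (-(((v - μ) / σ) * q) + α ^ 2 * q ^ 2 / 2) :=
    (continuous_Phi.comp (by fun_prop)).mul (by fun_prop)
  rw [intervalIntegral.integral_eq_sub_of_hasDerivAt (fun v _ => hderiv v)
    (hcont.intervalIntegrable a b)]
  ring
end

section
/- Let μ ∈ ℝ, σ > 0, p ∈ (0,1), α > 0, and let f be the GAL(μ,σ,p,α) density. Then for every t with (p−1)/σ < t < p/σ, the moment generating function satisfies ∫_ℝ exp(ty) f(y) dy = 2p(1−p) · [ (p⁺ − p⁻) / ((p⁻ − σt)(p⁺ − σt)) ] · exp( μt + α²σ²t²/2 ) · Φ(|α|σt), where for α > 0 one has p⁻ = p and p⁺ = p − 1. -/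
open MeasureTheory Real Set

/-- The GAL(μ,σ,p,α) probability density function. -/
noncomputable def galPdf (μ σ p α y : ℝ) : ℝ :=
  let ys := (y - μ) / σ
  let pp := p - (if 0 < α then 1 else 0)
  let pm := p - (if α < 0 then 1 else 0)
  (2 * p * (1 - p) / σ) *
    ((Phi (ys / α - α * pm) - Phi (-(α * pm))) *
        Real.exp (-(ys * pm) + (α * pm) ^ 2 / 2) *
        (if 0 < ys / α then 1 else 0) +
      Phi (α * pp - ys / α * (if 0 < ys / α then 1 else 0)) *
        Real.exp (-(ys * pp) + (α * pp) ^ 2 / 2))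

open ProbabilityTheory Filter Topology

lemma Phi_eq_setIntegral_gaussianPDFReal (x : ℝ) :
    Phi x = ∫ t in Set.Iic x, gaussianPDFReal 0 1 t := by
  simp [Phi, gaussianPDFReal_def]

lemma Phi_eq_gaussianReal (x : ℝ) : Phi x = (gaussianReal 0 1).real (Set.Iic x) := by
  rw [measureReal_def, gaussianReal_apply_eq_integral 0 one_ne_zero, ENNReal.toReal_ofReal,
    Phi_eq_setIntegral_gaussianPDFReal]
  exact integral_nonneg fun t => gaussianPDFReal_nonneg 0 1 t

lemma Phi_nonneg (x : ℝ) : 0 ≤ Phi x := by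
  rw [Phi_eq_gaussianReal]; exact measureReal_nonneg

lemma Phi_mono : Monotone Phi := fun x y h => by
  simp only [Phi_eq_gaussianReal]
  exact measureReal_mono (Set.Iic_subset_Iic.2 h)

lemma tendsto_Phi_atTop : Tendsto Phi atTop (𝓝 1) := by
  convert tendsto_cdf_atTop (gaussianReal 0 1) using 1
  ext x
  rw [Phi_eq_gaussianReal, cdf_eq_real]

lemma Phi_neg (x : ℝ) : Phi (-x) = 1 - Phi x := by
  have h := intervalIntegral.integral_Iic_add_Ioi (b := x)
    (integrable_gaussianPDFReal 0 1).integrableOn (integrable_gaussianPDFReal 0 1).integrableOn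
  rw [integral_gaussianPDFReal_eq_one 0 one_ne_zero, ← Phi_eq_setIntegral_gaussianPDFReal] at h
  have h' := integral_comp_neg_Iic (-x) (gaussianPDFReal 0 1)
  have heven : ∀ t, gaussianPDFReal 0 1 (-t) = gaussianPDFReal 0 1 t := by
    simp [gaussianPDFReal_def]
  simp only [heven, neg_neg, ← Phi_eq_setIntegral_gaussianPDFReal] at h'
  linarith

lemma hasDerivAt_Phi_s9 (x : ℝ) : HasDerivAt Phi (gaussianPDFReal 0 1 x) x := by
  have hc : Continuous (gaussianPDFReal 0 1) := by
    rw [gaussianPDFReal_def]; fun_prop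
  have h := (hc.integral_hasStrictDerivAt 0 x).hasDerivAt.const_add (Phi 0)
  refine h.congr_of_eventuallyEq (Eventually.of_forall fun y => ?_)
  have := intervalIntegral.integral_Iic_sub_Iic (a := 0) (b := y)
    (integrable_gaussianPDFReal 0 1).integrableOn (integrable_gaussianPDFReal 0 1).integrableOn
  simp only [← Phi_eq_setIntegral_gaussianPDFReal] at this
  simp only [← this]
  ring

/-- Chernoff bound for the lower tail of the standard normal distribution. -/
lemma Phi_le_exp {l : ℝ} (hl : 0 ≤ l) (x : ℝ) : Phi x ≤ rexp (l * x + l ^ 2 / 2) := by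
  have h := measure_le_le_exp_mul_mgf (X := id) (μ := gaussianReal 0 1) (t := -l) x
    (by linarith) (integrable_exp_mul_gaussianReal (-l))
  rw [mgf_id_gaussianReal, ← Real.exp_add] at h
  rw [Phi_eq_gaussianReal]
  refine h.trans_eq ?_
  simp

lemma gaussianPDFReal_mul_exp_tilt {α : ℝ} (hα : α ≠ 0) (m s z : ℝ) :
    gaussianPDFReal 0 1 (z / α - α * m) * rexp (s * z + (-(z * m) + (α * m) ^ 2 / 2)) =
      gaussianPDFReal 0 1 (z / α - α * s) * rexp ((α * s) ^ 2 / 2) := by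
  simp only [gaussianPDFReal_def, mul_assoc, ← Real.exp_add]
  congr 2
  simp only [NNReal.coe_one]
  field_simp
  ring

/-- An antiderivative of an exponentially tilted normal CDF. -/
noncomputable def tiltedPrimitive (α m s c z : ℝ) : ℝ :=
  ((Phi (z / α - α * m) - c) * rexp (s * z + (-(z * m) + (α * m) ^ 2 / 2)) -
    rexp ((α * s) ^ 2 / 2) * Phi (z / α - α * s)) / (s - m)

lemma hasDerivAt_tiltedPrimitive {α m s : ℝ} (hα : α ≠ 0) (hm : s ≠ m) (c z : ℝ) :
    HasDerivAt (tiltedPrimitive α m s c)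
      ((Phi (z / α - α * m) - c) * rexp (s * z + (-(z * m) + (α * m) ^ 2 / 2))) z := by
  have harg : ∀ k : ℝ, HasDerivAt (fun z : ℝ => z / α - α * k) (1 / α) z := fun k =>
    ((hasDerivAt_id z).div_const α).sub_const _
  have hPhi : ∀ k : ℝ, HasDerivAt (fun z : ℝ => Phi (z / α - α * k))
      (gaussianPDFReal 0 1 (z / α - α * k) * (1 / α)) z := fun k =>
    HasDerivAt.comp z (hasDerivAt_Phi_s9 _) (harg k)
  have hexp : HasDerivAt (fun z : ℝ => rexp (s * z + (-(z * m) + (α * m) ^ 2 / 2)))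
      (rexp (s * z + (-(z * m) + (α * m) ^ 2 / 2)) * (s * 1 + -(1 * m))) z :=
    (((hasDerivAt_id z).const_mul s).add
      (((hasDerivAt_id z).mul_const m).neg.add_const _)).exp
  have h := ((((hPhi m).sub_const c).mul hexp).sub
    ((hPhi s).const_mul (rexp ((α * s) ^ 2 / 2)))).div_const (s - m)
  refine h.congr_deriv ?_
  have key := gaussianPDFReal_mul_exp_tilt hα m s z
  rw [div_eq_iff (sub_ne_zero.2 hm)]
  linear_combination (1 / α) * key

lemma tendsto_Phi_div_sub {α : ℝ} (hα : 0 < α) (b : ℝ) :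
    Tendsto (fun z => Phi (z / α - b)) atTop (𝓝 1) :=
  tendsto_Phi_atTop.comp
    (tendsto_atTop_add_const_right _ (-b) (tendsto_id.atTop_div_const hα))

lemma tendsto_tiltedPrimitive {α m s c : ℝ} (hα : 0 < α)
    (h : Tendsto (fun z => (Phi (z / α - α * m) - c) *
      rexp (s * z + (-(z * m) + (α * m) ^ 2 / 2))) atTop (𝓝 0)) :
    Tendsto (tiltedPrimitive α m s c) atTop (𝓝 (-rexp ((α * s) ^ 2 / 2) / (s - m))) := by
  have := (h.sub ((tendsto_Phi_div_sub hα (α * s)).const_mul (rexp ((α * s) ^ 2 / 2)))).div_const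
    (s - m)
  simp only [zero_sub, mul_one] at this
  exact this

lemma tendsto_tiltedPrimitive_of_lt {α m s : ℝ} (hα : 0 < α) (hs : s < m) (c : ℝ) :
    Tendsto (tiltedPrimitive α m s c) atTop (𝓝 (-rexp ((α * s) ^ 2 / 2) / (s - m))) := by
  refine tendsto_tiltedPrimitive hα ?_
  have hexp : Tendsto (fun z : ℝ => rexp (s * z + (-(z * m) + (α * m) ^ 2 / 2))) atTop (𝓝 0) := by
    refine Real.tendsto_exp_atBot.comp ?_
    have := tendsto_atBot_add_const_right atTop ((α * m) ^ 2 / 2)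
      ((tendsto_id (α := ℝ)).const_mul_atTop_of_neg (sub_neg.2 hs))
    refine this.congr fun z => ?_
    simp only [id]
    ring
  simpa using ((tendsto_Phi_div_sub hα (α * m)).sub_const c).mul hexp

lemma tendsto_tiltedPrimitive_of_gt {α m s : ℝ} (hα : 0 < α) (hs : m < s) :
    Tendsto (tiltedPrimitive α m s 1) atTop (𝓝 (-rexp ((α * s) ^ 2 / 2) / (s - m))) := by
  refine tendsto_tiltedPrimitive hα ?_
  set l := α * (s - m + 1)
  have hl : 0 ≤ l := mul_nonneg hα.le (by linarith)
  have hbound : Tendsto (fun z : ℝ => rexp (-z + (l * α * m + l ^ 2 / 2 + (α * m) ^ 2 / 2)))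
      atTop (𝓝 0) :=
    Real.tendsto_exp_atBot.comp (tendsto_atBot_add_const_right _ _ tendsto_neg_atTop_atBot)
  refine squeeze_zero_norm (fun z => ?_) hbound
  have hrefl : Phi (z / α - α * m) - 1 = -Phi (-(z / α - α * m)) := by
    rw [Phi_neg]; ring
  rw [hrefl, norm_mul, norm_neg, Real.norm_of_nonneg (Phi_nonneg _),
    Real.norm_of_nonneg (Real.exp_pos _).le]
  refine (mul_le_mul_of_nonneg_right (Phi_le_exp hl _) (Real.exp_pos _).le).trans_eq ?_
  rw [← Real.exp_add]
  congr 1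
  have : l * (z / α) = (s - m + 1) * z := by
    simp only [l]; field_simp
  linear_combination -this

/-- The integral over `ℝ` of the exponentially tilted standardized GAL kernel. -/
lemma integral_gal_kernel {α m q s : ℝ} (hα : 0 < α) (hs : s < m) (hq : q < s) :
    ∫ z : ℝ, rexp (s * z) *
      ((Phi (z / α - α * m) - Phi (-(α * m))) * rexp (-(z * m) + (α * m) ^ 2 / 2) *
          (if 0 < z / α then 1 else 0) +
        Phi (α * q - z / α * (if 0 < z / α then 1 else 0)) *
          rexp (-(z * q) + (α * q) ^ 2 / 2)) =
      (1 / (m - s) + 1 / (s - q)) * (rexp ((α * s) ^ 2 / 2) * Phi (α * s)) := by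
  set F : ℝ → ℝ := fun z => rexp (s * z) *
      ((Phi (z / α - α * m) - Phi (-(α * m))) * rexp (-(z * m) + (α * m) ^ 2 / 2) *
          (if 0 < z / α then 1 else 0) +
        Phi (α * q - z / α * (if 0 < z / α then 1 else 0)) *
          rexp (-(z * q) + (α * q) ^ 2 / 2)) with hF
  have hIic : ∀ z ∈ Set.Iic (0 : ℝ),
      F z = Phi (α * q) * rexp ((α * q) ^ 2 / 2) * rexp ((s - q) * z) := by
    intro z hz
    have hz' : ¬ 0 < z / α := not_lt.2 (div_nonpos_of_nonpos_of_nonneg hz hα.le)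
    have hexp : rexp (s * z) * rexp (-(z * q) + (α * q) ^ 2 / 2) =
        rexp ((α * q) ^ 2 / 2) * rexp ((s - q) * z) := by
      rw [← Real.exp_add, ← Real.exp_add]; congr 1; ring
    simp only [hF, hz', if_false, mul_zero, sub_zero, zero_add]
    linear_combination Phi (α * q) * hexp
  set G : ℝ → ℝ := fun z => tiltedPrimitive α m s (Phi (-(α * m))) z - tiltedPrimitive α q s 1 z
    with hG
  set g : ℝ → ℝ := fun z =>
    (Phi (z / α - α * m) - Phi (-(α * m))) * rexp (s * z + (-(z * m) + (α * m) ^ 2 / 2)) -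
    (Phi (z / α - α * q) - 1) * rexp (s * z + (-(z * q) + (α * q) ^ 2 / 2)) with hg
  have hIoi : ∀ z ∈ Set.Ioi (0 : ℝ), F z = g z := by
    intro z hz
    have hz' : 0 < z / α := div_pos hz hα
    have hrefl : Phi (α * q - z / α) = 1 - Phi (z / α - α * q) := by
      rw [← Phi_neg, neg_sub]
    simp only [hF, hg, hz', if_true, mul_one, hrefl, Real.exp_add (s * z)]
    ring
  have hderiv : ∀ z ∈ Set.Ici (0 : ℝ), HasDerivAt G (g z) z := fun z _ =>
    (hasDerivAt_tiltedPrimitive hα.ne' hs.ne _ z).sub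
      (hasDerivAt_tiltedPrimitive hα.ne' hq.ne' 1 z)
  have hnonneg : ∀ z ∈ Set.Ioi (0 : ℝ), 0 ≤ g z := by
    intro z hz
    have hz' : 0 < z / α := div_pos hz hα
    have h₁ : Phi (-(α * m)) ≤ Phi (z / α - α * m) := Phi_mono (by linarith)
    have h₂ : Phi (z / α - α * q) ≤ 1 := by
      have := Phi_nonneg (-(z / α - α * q))
      rw [Phi_neg] at this
      linarith
    have := mul_nonneg (sub_nonneg.2 h₁) (Real.exp_pos (s * z + (-(z * m) + (α * m) ^ 2 / 2))).le
    have := mul_nonneg (sub_nonneg.2 h₂) (Real.exp_pos (s * z + (-(z * q) + (α * q) ^ 2 / 2))).le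
    simp only [hg]
    linarith
  have hlim : Tendsto G atTop (𝓝 (-rexp ((α * s) ^ 2 / 2) / (s - m) -
      -rexp ((α * s) ^ 2 / 2) / (s - q))) :=
    (tendsto_tiltedPrimitive_of_lt hα hs _).sub (tendsto_tiltedPrimitive_of_gt hα hq)
  have hIicInt : IntegrableOn (fun z => Phi (α * q) * rexp ((α * q) ^ 2 / 2) * rexp ((s - q) * z))
      (Set.Iic 0) := (integrableOn_exp_mul_Iic (sub_pos.2 hq) 0).const_mul _
  rw [← intervalIntegral.integral_Iic_add_Ioi (b := 0)
      (hIicInt.congr_fun (fun z hz => (hIic z hz).symm) measurableSet_Iic)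
      ((integrableOn_Ioi_deriv_of_nonneg' hderiv hnonneg hlim).congr_fun
        (fun z hz => (hIoi z hz).symm) measurableSet_Ioi),
    setIntegral_congr_fun measurableSet_Iic hIic, setIntegral_congr_fun measurableSet_Ioi hIoi,
    integral_Ioi_of_hasDerivAt_of_nonneg' hderiv hnonneg hlim, integral_const_mul,
    integral_exp_mul_Iic (sub_pos.2 hq)]
  have h₁ : m - s ≠ 0 := (sub_pos.2 hs).ne'
  have h₂ : s - q ≠ 0 := (sub_pos.2 hq).ne'
  have h₃ : s - m = -(m - s) := by ring
  simp only [hG, tiltedPrimitive, h₃, zero_div, zero_sub, zero_mul, mul_zero, neg_zero, zero_add,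
    Real.exp_zero, Phi_neg]
  field_simp
  ring

/-- The moment generating function of the GAL distribution (case α > 0, where
p⁻ = p and p⁺ = p − 1). -/
theorem gal_mgf (μ σ p α t : ℝ) (hσ : 0 < σ) (hp : p ∈ Set.Ioo (0 : ℝ) 1)
    (hα : 0 < α) (ht₁ : (p - 1) / σ < t) (ht₂ : t < p / σ) :
    (∫ y : ℝ, Real.exp (t * y) * galPdf μ σ p α y) =
      2 * p * (1 - p) * (((p - 1) - p) / ((p - σ * t) * ((p - 1) - σ * t))) *
        Real.exp (μ * t + α ^ 2 * σ ^ 2 * t ^ 2 / 2) * Phi (|α| * σ * t) := by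
  have hs₁ : p - 1 < σ * t := by rwa [div_lt_iff₀' hσ] at ht₁
  have hs₂ : σ * t < p := by rwa [lt_div_iff₀' hσ] at ht₂
  set K : ℝ → ℝ := fun z => rexp (σ * t * z) *
      ((Phi (z / α - α * p) - Phi (-(α * p))) * rexp (-(z * p) + (α * p) ^ 2 / 2) *
          (if 0 < z / α then 1 else 0) +
        Phi (α * (p - 1) - z / α * (if 0 < z / α then 1 else 0)) *
          rexp (-(z * (p - 1)) + (α * (p - 1)) ^ 2 / 2)) with hK
  have hpoint : ∀ y, rexp (t * y) * galPdf μ σ p α y =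
      rexp (μ * t) * (2 * p * (1 - p) / σ) * K ((y - μ) / σ) := by
    intro y
    have hexp : rexp (t * y) = rexp (μ * t) * rexp (σ * t * ((y - μ) / σ)) := by
      rw [← Real.exp_add]
      congr 1
      field_simp
      ring
    simp only [galPdf, hK, hα, not_lt.2 hα.le, if_true, if_false, sub_zero, hexp]
    ring
  have hscale : ∫ y : ℝ, K ((y - μ) / σ) = σ * ∫ z, K z := by
    rw [integral_sub_right_eq_self (fun y => K (y / σ)) μ, Measure.integral_comp_div,
      abs_of_pos hσ, smul_eq_mul]
  simp only [hpoint]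
  rw [integral_const_mul, hscale, integral_gal_kernel hα hs₂ hs₁, abs_of_pos hα, Real.exp_add,
    show α ^ 2 * σ ^ 2 * t ^ 2 / 2 = (α * (σ * t)) ^ 2 / 2 by ring, mul_assoc α σ t]
  have h₁ : p - σ * t ≠ 0 := (sub_pos.2 hs₂).ne'
  have h₂ : σ * t - (p - 1) ≠ 0 := (sub_pos.2 hs₁).ne'
  have hfrac : 1 / (p - σ * t) + 1 / (σ * t - (p - 1)) =
      ((p - 1) - p) / ((p - σ * t) * ((p - 1) - σ * t)) := by
    rw [← neg_sub (σ * t) (p - 1), div_add_div _ _ h₁ h₂,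
      div_eq_div_iff (mul_ne_zero h₁ h₂) (mul_ne_zero h₁ (neg_ne_zero.2 h₂))]
    ring
  rw [hfrac]
  generalize ((p - 1) - p) / ((p - σ * t) * ((p - 1) - σ * t)) = R
  field_simp
end
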